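/- For any fixed finite tree T on at least 2 vertices, lim_{k→∞} δ(S_k, T) = 1, where S_k denotes the star on k vertices and δ(S,T) = lim_{n→∞} TV(PA(n,S), PA(n,T)). -/

import Mathlib

open MeasureTheory Filter Real
open scoped ENNReal

noncomputable section

/-- The degree of vertex `v` in a graph on `ℕ`. -/
def degN (G : SimpleGraph ℕ) (v : ℕ) : ℕ := (G.neighborSet v).ncard

/-- `G` is a tree on the vertex set `{0, …, k-1}` (all other vertices isolated). -/
def IsTreeOn (k : ℕ) (G : SimpleGraph ℕ) : Prop :=
  (∀ v w : ℕ, G.Adj v w → v < k ∧ w < k) ∧ (G.induce {v : ℕ | v < k}).IsTree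

instance : MeasurableSpace (SimpleGraph ℕ) := ⊤

/-- Add the edge `uv` to `G`. -/
def addEdge (G : SimpleGraph ℕ) (u v : ℕ) : SimpleGraph ℕ :=
  G ⊔ SimpleGraph.fromEdgeSet {s(u, v)}

/-- One step of preferential attachment: the current graph has `n` vertices `0, …, n-1`;
the new vertex `n` attaches to an existing vertex `v` with probability `deg v / (2(n-1))`. -/
def paStep (n : ℕ) (G : SimpleGraph ℕ) : Measure (SimpleGraph ℕ) :=
  Measure.sum fun v : ℕ =>
    ((degN G v : ℝ≥0∞) / ((2 * (n - 1) : ℕ) : ℝ≥0∞)) • Measure.dirac (addEdge G n v)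

def PAlawAux (k : ℕ) (T : SimpleGraph ℕ) : ℕ → Measure (SimpleGraph ℕ)
  | 0 => Measure.dirac T
  | m + 1 => (PAlawAux k T m).bind (paStep (k + m))

/-- The law of `PA(n, T)` for a seed tree `T` on `k` vertices, as a measure on labelled
graphs on `ℕ` (vertices are labelled `0, 1, 2, …` in order of arrival). -/
def PAlaw (k : ℕ) (T : SimpleGraph ℕ) (n : ℕ) : Measure (SimpleGraph ℕ) :=
  PAlawAux k T (n - k)

/-- Graphs on `ℕ` up to isomorphism. -/
def graphSetoid : Setoid (SimpleGraph ℕ) where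
  r G H := Nonempty (G ≃g H)
  iseqv := ⟨fun G => ⟨RelIso.refl G.Adj⟩, fun ⟨e⟩ => ⟨e.symm⟩, fun ⟨e⟩ ⟨f⟩ => ⟨e.trans f⟩⟩

/-- Isomorphism types of graphs on `ℕ`. -/
def GraphType : Type := Quotient graphSetoid

instance : MeasurableSpace GraphType := ⊤

/-- The law of the isomorphism type of `PA(n, T)`. -/
def PAtype (k : ℕ) (T : SimpleGraph ℕ) (n : ℕ) : Measure GraphType :=
  (PAlaw k T n).map (Quotient.mk graphSetoid)

/-- Total variation distance between two measures. -/
def tvDist {α : Type*} [MeasurableSpace α] (μ ν : Measure α) : ℝ :=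
  ⨆ A : Set α, |(μ A).toReal - (ν A).toReal|

/-- `δ(S, T) = lim_n TV(PA(n,S), PA(n,T))`, the total variation distance being taken
between the laws of the isomorphism types.  The limit exists since the sequence is
non-increasing; we express it as a `limsup`, which agrees with the limit. -/
def deltaPA (kS : ℕ) (S : SimpleGraph ℕ) (kT : ℕ) (T : SimpleGraph ℕ) : ℝ :=
  Filter.limsup (fun n : ℕ => tvDist (PAtype kS S n) (PAtype kT T n)) Filter.atTop


/-- The star on `k` vertices `0, …, k-1`, centered at `0`. -/
def starGraph (k : ℕ) : SimpleGraph ℕ :=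
  SimpleGraph.fromEdgeSet {e : Sym2 ℕ | ∃ i : ℕ, 0 < i ∧ i < k ∧ e = s(0, i)}


/-- `G` is a graph on the vertex set `{0, …, n-1}` with `n - 1` edges. -/
structure HasTreeSize (n : ℕ) (G : SimpleGraph ℕ) : Prop where
  adj_lt : ∀ v w : ℕ, G.Adj v w → v < n ∧ w < n
  sum_degN : ∑ v ∈ Finset.range n, degN G v = 2 * (n - 1)

theorem degN_eq_of_iso {G H : SimpleGraph ℕ} (e : G ≃g H) (v : ℕ) :
    degN H (e v) = degN G v := by
  have h : H.neighborSet (e v) = e '' G.neighborSet v := by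
    ext w
    constructor
    · intro hw
      refine ⟨e.symm w, ?_, by simp⟩
      have : H.Adj (e v) (e (e.symm w)) := by simpa using hw
      exact e.map_adj_iff.mp this
    · rintro ⟨u, hu, rfl⟩
      exact e.map_adj_iff.mpr hu
  rw [degN, h, Set.ncard_image_of_injective _ e.injective, degN]

theorem IsTreeOn.hasTreeSize {k : ℕ} {T : SimpleGraph ℕ} (hT : IsTreeOn k T) :
    HasTreeSize k T := by
  classical
  refine ⟨hT.1, ?_⟩
  have : Fintype {v : ℕ | v < k} := (Set.finite_lt_nat k).fintype
  have hsum := (T.induce {v : ℕ | v < k}).sum_degrees_eq_twice_card_edges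
  have hcard := hT.2.card_edgeFinset
  have hk : Fintype.card {v : ℕ | v < k} = k := by
    have h : {v : ℕ | v < k} = (Finset.range k : Set ℕ) := by ext; simp
    rw [← Nat.card_eq_fintype_card, Nat.card_coe_set_eq, h, Set.ncard_coe_finset,
      Finset.card_range]
  have hdeg : ∀ v : {v : ℕ | v < k}, (T.induce {v : ℕ | v < k}).degree v = degN T v := by
    intro v
    rw [← SimpleGraph.card_neighborSet_eq_degree, ← Nat.card_eq_fintype_card,
      Nat.card_coe_set_eq, degN,
      ← Set.ncard_image_of_injective _ (Subtype.val_injective (p := fun v => v < k))]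
    congr 1
    ext w
    constructor
    · rintro ⟨u, hu, rfl⟩
      exact hu
    · intro hw
      exact ⟨⟨w, (hT.1 _ _ hw).2⟩, hw, rfl⟩
  simp_rw [hdeg] at hsum
  have h2 : ∑ v ∈ Finset.range k, degN T v = ∑ v : {v : ℕ | v < k}, degN T v := by
    apply Finset.sum_subtype
    simp
  rw [h2, hsum]
  omega

theorem degN_starGraph_zero (k : ℕ) : degN (starGraph k) 0 = k - 1 := by
  have h : (starGraph k).neighborSet 0 = (Finset.Ico 1 k : Finset ℕ) := by
    ext w
    simp only [starGraph, SimpleGraph.mem_neighborSet, SimpleGraph.fromEdgeSet_adj,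
      Set.mem_ofPred_eq, Finset.coe_Ico, Set.mem_Ico]
    constructor
    · rintro ⟨⟨i, h0, hk, hi⟩, hne⟩
      simp at hi
      omega
    · rintro ⟨h1, h2⟩
      exact ⟨⟨w, h1, h2, rfl⟩, by omega⟩
  rw [degN, h, Set.ncard_coe_finset]
  simp

theorem degN_starGraph_of_pos {k v : ℕ} (hv : 0 < v) (hvk : v < k) :
    degN (starGraph k) v = 1 := by
  have h : (starGraph k).neighborSet v = {0} := by
    ext w
    simp only [starGraph, SimpleGraph.mem_neighborSet, SimpleGraph.fromEdgeSet_adj,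
      Set.mem_ofPred_eq, Set.mem_singleton_iff]
    constructor
    · rintro ⟨⟨i, h0, hk, hi⟩, hne⟩
      simp at hi
      omega
    · rintro rfl
      exact ⟨⟨v, hv, hvk, Sym2.eq_swap⟩, by omega⟩
  rw [degN, h, Set.ncard_singleton]

theorem hasTreeSize_starGraph {k : ℕ} (hk : 1 ≤ k) : HasTreeSize k (starGraph k) := by
  constructor
  · intro v w h
    simp only [starGraph, SimpleGraph.fromEdgeSet_adj, Set.mem_ofPred_eq] at h
    obtain ⟨⟨i, h0, hk, hi⟩, hne⟩ := h
    simp at hi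
    omega
  · obtain ⟨m, rfl⟩ : ∃ m, k = m + 1 := ⟨k - 1, by omega⟩
    rw [Finset.sum_range_succ', degN_starGraph_zero,
      Finset.sum_congr rfl (g := fun _ => 1)]
    · simp; omega
    · intro i hi
      rw [Finset.mem_range] at hi
      exact degN_starGraph_of_pos (by omega) (by omega)

theorem neighborSet_addEdge (G : SimpleGraph ℕ) (u v w : ℕ) (huv : u ≠ v) :
    (addEdge G u v).neighborSet w =
      G.neighborSet w ∪ {x | (w = u ∧ x = v) ∨ (w = v ∧ x = u)} := by
  ext x
  simp only [addEdge, SimpleGraph.mem_neighborSet, SimpleGraph.sup_adj,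
    SimpleGraph.fromEdgeSet_adj, Set.mem_singleton_iff, Set.mem_union, Set.mem_ofPred_eq,
    Sym2.eq_iff]
  have : (w = u ∧ x = v ∨ w = v ∧ x = u) → w ≠ x := by
    rintro (⟨rfl, rfl⟩ | ⟨rfl, rfl⟩)
    · exact huv
    · exact huv.symm
  tauto

theorem HasTreeSize.degN_addEdge {n : ℕ} {G : SimpleGraph ℕ} (hG : HasTreeSize n G) {v : ℕ}
    (hv : v < n) {w : ℕ} (hw : w < n) :
    degN (addEdge G n v) w = degN G w + if w = v then 1 else 0 := by
  rw [degN, neighborSet_addEdge G n v w (by omega)]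
  split_ifs with h
  · have h1 : {x | (w = n ∧ x = v) ∨ (w = v ∧ x = n)} = {n} := by
      ext x
      simp only [Set.mem_ofPred_eq, Set.mem_singleton_iff]
      omega
    have hn : n ∉ G.neighborSet w := fun hx => lt_irrefl n (hG.adj_lt _ _ hx).2
    have hfin : (G.neighborSet w).Finite :=
      (Set.finite_lt_nat n).subset fun x hx => (hG.adj_lt _ _ hx).2
    rw [h1, Set.union_singleton, Set.ncard_insert_of_notMem hn hfin, degN]
  · have h1 : {x | (w = n ∧ x = v) ∨ (w = v ∧ x = n)} = ∅ := by
      rw [Set.eq_empty_iff_forall_notMem]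
      rintro x (h' | h') <;> omega
    rw [h1, Set.union_empty, degN, add_zero]

theorem HasTreeSize.degN_addEdge_self {n : ℕ} {G : SimpleGraph ℕ} (hG : HasTreeSize n G)
    {v : ℕ} (hv : v < n) : degN (addEdge G n v) n = 1 := by
  rw [degN, neighborSet_addEdge G n v n (by omega)]
  have h1 : G.neighborSet n ∪ {x | (n = n ∧ x = v) ∨ (n = v ∧ x = n)} = {v} := by
    ext x
    simp only [Set.mem_union, SimpleGraph.mem_neighborSet, Set.mem_ofPred_eq,
      Set.mem_singleton_iff]
    constructor
    · rintro (h | h)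
      · exact absurd (hG.adj_lt _ _ h).1 (lt_irrefl n)
      · omega
    · rintro rfl
      simp
  rw [h1, Set.ncard_singleton]

theorem HasTreeSize.degN_eq_zero {n : ℕ} {G : SimpleGraph ℕ} (hG : HasTreeSize n G) {v : ℕ}
    (hv : n ≤ v) : degN G v = 0 := by
  have h : G.neighborSet v = ∅ := by
    ext x
    simp only [SimpleGraph.mem_neighborSet, Set.mem_empty_iff_false, iff_false]
    intro h
    exact absurd (hG.adj_lt _ _ h).1 (by omega)
  rw [degN, h, Set.ncard_empty]

theorem HasTreeSize.lt_of_degN_ne_zero {n : ℕ} {G : SimpleGraph ℕ} (hG : HasTreeSize n G)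
    {v : ℕ} (hv : degN G v ≠ 0) : v < n := by
  by_contra h
  exact hv (hG.degN_eq_zero (by omega))

theorem HasTreeSize.addEdge {n : ℕ} {G : SimpleGraph ℕ} (hG : HasTreeSize n G) {v : ℕ}
    (hv : v < n) : HasTreeSize (n + 1) (addEdge G n v) := by
  constructor
  · intro a b h
    change b ∈ (_root_.addEdge G n v).neighborSet a at h
    rw [neighborSet_addEdge G n v a (by omega)] at h
    rcases h with h | h
    · have := hG.adj_lt _ _ h
      omega
    · simp only [Set.mem_ofPred_eq] at h
      omega
  · rw [Finset.sum_range_succ, hG.degN_addEdge_self hv,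
      Finset.sum_congr rfl fun w hw => hG.degN_addEdge hv (Finset.mem_range.mp hw),
      Finset.sum_add_distrib, hG.sum_degN, Finset.sum_ite_eq', if_pos (Finset.mem_range.mpr hv)]
    omega

theorem HasTreeSize.lintegral_paStep {n : ℕ} {G : SimpleGraph ℕ} (hG : HasTreeSize n G)
    (f : SimpleGraph ℕ → ℝ≥0∞) :
    ∫⁻ H, f H ∂paStep n G = ∑ v ∈ Finset.range n,
      (degN G v : ℝ≥0∞) / ((2 * (n - 1) : ℕ) : ℝ≥0∞) * f (_root_.addEdge G n v) := by
  rw [paStep, lintegral_sum_measure]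
  simp_rw [lintegral_smul_measure, lintegral_dirac, smul_eq_mul]
  apply tsum_eq_sum
  intro v hv
  rw [hG.degN_eq_zero (by simpa using hv)]
  simp

theorem HasTreeSize.lintegral_paStep_ofReal {n : ℕ} (hn : 2 ≤ n) {G : SimpleGraph ℕ}
    (hG : HasTreeSize n G) (f : SimpleGraph ℕ → ℝ) (hf : ∀ H, 0 ≤ f H) :
    ∫⁻ H, ENNReal.ofReal (f H) ∂paStep n G = ENNReal.ofReal (∑ v ∈ Finset.range n,
      (degN G v : ℝ) / (2 * ((n : ℝ) - 1)) * f (_root_.addEdge G n v)) := by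
  have hn' : (0 : ℝ) < 2 * ((n : ℝ) - 1) := by
    have : (2 : ℝ) ≤ n := by exact_mod_cast hn
    linarith
  rw [hG.lintegral_paStep, ENNReal.ofReal_sum_of_nonneg]
  · refine Finset.sum_congr rfl fun v _ => ?_
    rw [ENNReal.ofReal_mul (by positivity), ENNReal.ofReal_div_of_pos hn', ENNReal.ofReal_natCast]
    congr 2
    rw [← ENNReal.ofReal_natCast]
    congr 1
    push_cast [Nat.cast_sub (show 1 ≤ n by omega)]
    ring
  · intro v _
    exact mul_nonneg (by positivity) (hf _)

theorem HasTreeSize.isProbabilityMeasure_paStep {n : ℕ} (hn : 2 ≤ n) {G : SimpleGraph ℕ}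
    (hG : HasTreeSize n G) : IsProbabilityMeasure (paStep n G) := by
  have hn' : (2 : ℝ) ≤ n := by exact_mod_cast hn
  have h := hG.lintegral_paStep_ofReal hn (fun _ => 1) fun _ => zero_le_one
  have hs : (∑ v ∈ Finset.range n, (degN G v : ℝ)) = 2 * ((n : ℝ) - 1) := by
    have := congrArg (Nat.cast : ℕ → ℝ) hG.sum_degN
    push_cast [Nat.cast_sub (show 1 ≤ n by omega)] at this
    exact this
  refine ⟨?_⟩
  simp only [mul_one] at h
  rw [← Finset.sum_div, hs, div_self (by linarith)] at h
  simpa using h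

theorem ae_paStep {n : ℕ} {G : SimpleGraph ℕ} {p : SimpleGraph ℕ → Prop}
    (h : ∀ v, degN G v ≠ 0 → p (addEdge G n v)) : ∀ᵐ H ∂paStep n G, p H := by
  rw [paStep, Measure.ae_sum_iff]
  intro v
  by_cases hv : degN G v = 0
  · simp [hv]
  · refine Measure.ae_smul_measure ?_ _
    rw [ae_dirac_iff MeasurableSpace.measurableSet_top]
    exact h v hv

theorem measurable_paStep (n : ℕ) : Measurable (paStep n) := measurable_from_top

theorem ae_PAlawAux {k : ℕ} {T : SimpleGraph ℕ} {I : ℕ → SimpleGraph ℕ → Prop} (h0 : I k T)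
    (hs : ∀ n G v, k ≤ n → I n G → degN G v ≠ 0 → I (n + 1) (addEdge G n v)) (m : ℕ) :
    ∀ᵐ G ∂PAlawAux k T m, I (k + m) G := by
  induction m with
  | zero =>
    rw [PAlawAux, ae_dirac_iff MeasurableSpace.measurableSet_top]
    exact h0
  | succ m ih =>
    have hz : (PAlawAux k T (m + 1)) {G | ¬ I (k + (m + 1)) G} = 0 := by
      rw [PAlawAux, Measure.bind_apply MeasurableSpace.measurableSet_top
        (measurable_paStep _).aemeasurable, lintegral_eq_zero_iff measurable_from_top]
      filter_upwards [ih] with G hG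
      exact ae_paStep fun v hv => hs (k + m) G v (Nat.le_add_right k m) hG hv
    exact hz

theorem lintegral_PAlawAux_le {k : ℕ} {T : SimpleGraph ℕ} {I : ℕ → SimpleGraph ℕ → Prop}
    (h0 : I k T) (hs : ∀ n G v, k ≤ n → I n G → degN G v ≠ 0 → I (n + 1) (addEdge G n v))
    {F : ℕ → SimpleGraph ℕ → ℝ≥0∞}
    (hF : ∀ n G, k ≤ n → I n G → ∫⁻ H, F (n + 1) H ∂paStep n G ≤ F n G) (m : ℕ) :
    ∫⁻ G, F (k + m) G ∂PAlawAux k T m ≤ F k T := by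
  induction m with
  | zero => simp [PAlawAux]
  | succ m ih =>
    refine le_trans ?_ ih
    rw [PAlawAux, Measure.lintegral_bind (measurable_paStep _).aemeasurable
      measurable_from_top.aemeasurable]
    refine lintegral_mono_ae ?_
    filter_upwards [ae_PAlawAux h0 hs m] with G hG
    exact hF _ _ (by omega) hG

theorem isProbabilityMeasure_PAlawAux {k : ℕ} (hk : 2 ≤ k) {T : SimpleGraph ℕ}
    (hT : HasTreeSize k T) (m : ℕ) : IsProbabilityMeasure (PAlawAux k T m) := by
  induction m with
  | zero => rw [PAlawAux]; infer_instance
  | succ m ih =>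
    refine ⟨?_⟩
    rw [PAlawAux, Measure.bind_apply .univ (measurable_paStep _).aemeasurable]
    rw [lintegral_congr_ae (g := fun _ => 1)]
    · simp
    · filter_upwards [ae_PAlawAux (I := HasTreeSize) hT
        (fun n G v _ hG hv => hG.addEdge (hG.lt_of_degN_ne_zero hv)) m] with G hG
      have := hG.isProbabilityMeasure_paStep (show 2 ≤ k + m by omega)
      exact measure_univ

theorem isProbabilityMeasure_PAtype {k : ℕ} (hk : 2 ≤ k) {T : SimpleGraph ℕ}
    (hT : HasTreeSize k T) (n : ℕ) : IsProbabilityMeasure (PAtype k T n) := by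
  have : IsProbabilityMeasure (PAlaw k T n) := isProbabilityMeasure_PAlawAux hk hT (n - k)
  exact Measure.isProbabilityMeasure_map measurable_from_top.aemeasurable

/-- The sum over vertices of the third rising factorial of the degree, compensated so that it
becomes a nonnegative supermartingale along preferential attachment. -/
def cubicPotential (n : ℕ) (G : SimpleGraph ℕ) : ℝ :=
  (∑ w ∈ Finset.range n, (degN G w : ℝ) * (degN G w + 1) * (degN G w + 2) + 12 * (n - 1)) /
    ((n - 1) * √(n - 1))

theorem HasTreeSize.sum_degN_cast {n : ℕ} (hn : 1 ≤ n) {G : SimpleGraph ℕ}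
    (hG : HasTreeSize n G) : (∑ v ∈ Finset.range n, (degN G v : ℝ)) = 2 * ((n : ℝ) - 1) := by
  have := congrArg (Nat.cast : ℕ → ℝ) hG.sum_degN
  push_cast [Nat.cast_sub hn] at this
  exact this

theorem cubicPotential_nonneg {n : ℕ} (hn : 1 ≤ n) (G : SimpleGraph ℕ) :
    0 ≤ cubicPotential n G := by
  have hn' : (0 : ℝ) ≤ (n : ℝ) - 1 := by
    have : (1 : ℝ) ≤ n := by exact_mod_cast hn
    linarith
  unfold cubicPotential
  positivity

theorem HasTreeSize.sum_cubicPotential_le {n : ℕ} (hn : 2 ≤ n) {G : SimpleGraph ℕ}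
    (hG : HasTreeSize n G) :
    ∑ v ∈ Finset.range n, (degN G v : ℝ) / (2 * ((n : ℝ) - 1)) *
      cubicPotential (n + 1) (_root_.addEdge G n v) ≤ cubicPotential n G := by
  obtain ⟨m, hm⟩ : ∃ m : ℝ, m = (n : ℝ) - 1 := ⟨_, rfl⟩
  have hm1 : 1 ≤ m := by
    have : (2 : ℝ) ≤ n := by exact_mod_cast hn
    linarith
  obtain ⟨S, hS⟩ : ∃ S : ℝ, S = ∑ w ∈ Finset.range n,
    (degN G w : ℝ) * (degN G w + 1) * (degN G w + 2) := ⟨_, rfl⟩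
  have hS0 : 0 ≤ S := by rw [hS]; positivity
  have hD := hG.sum_degN_cast (by omega)
  have hstep : ∀ v ∈ Finset.range n, cubicPotential (n + 1) (_root_.addEdge G n v) =
      (S + 3 * (degN G v + 1) * (degN G v + 2) + 6 + 12 * (m + 1)) / ((m + 1) * √(m + 1)) := by
    intro v hv
    have hvn := Finset.mem_range.mp hv
    have hsum : ∑ w ∈ Finset.range n, (degN (_root_.addEdge G n v) w : ℝ) *
        (degN (_root_.addEdge G n v) w + 1) * (degN (_root_.addEdge G n v) w + 2) =
        S + 3 * (degN G v + 1) * (degN G v + 2) := by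
      rw [hS, ← Finset.sum_ite_eq' (Finset.range n) v
        (fun w => 3 * ((degN G w : ℝ) + 1) * (degN G w + 2)) |>.trans (if_pos hv),
        ← Finset.sum_add_distrib]
      refine Finset.sum_congr rfl fun w hw => ?_
      rw [hG.degN_addEdge hvn (Finset.mem_range.mp hw)]
      split_ifs
      · push_cast; ring
      · push_cast; ring
    rw [cubicPotential, Finset.sum_range_succ, hsum, hG.degN_addEdge_self hvn]
    have : ((n + 1 : ℕ) : ℝ) - 1 = m + 1 := by push_cast; linarith
    rw [this]
    norm_num
  rw [Finset.sum_congr rfl fun v hv => by rw [hstep v hv], ← hm]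
  have hsplit : ∀ v : ℕ, (degN G v : ℝ) / (2 * m) *
      ((S + 3 * (degN G v + 1) * (degN G v + 2) + 6 + 12 * (m + 1)) / ((m + 1) * √(m + 1))) =
      (degN G v : ℝ) * ((S + 6 + 12 * (m + 1)) / (2 * m * ((m + 1) * √(m + 1)))) +
      ((degN G v : ℝ) * (degN G v + 1) * (degN G v + 2)) *
        (3 / (2 * m * ((m + 1) * √(m + 1)))) := by
    intro v
    field_simp
    ring
  simp_rw [hsplit]
  rw [Finset.sum_add_distrib, ← Finset.sum_mul, ← Finset.sum_mul, hD, ← hS, ← hm, cubicPotential,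
    ← hS, ← hm]
  have hm0 : 0 < √m := Real.sqrt_pos.mpr (by linarith)
  have hm0' : 0 < √(m + 1) := Real.sqrt_pos.mpr (by linarith)
  have hsq : (m + 3 / 2) * √m ≤ (m + 1) * √(m + 1) := by
    apply le_of_sq_le_sq _ (by positivity)
    rw [mul_pow, mul_pow, Real.sq_sqrt (by linarith), Real.sq_sqrt (by linarith)]
    nlinarith
  have e : 2 * m * ((S + 6 + 12 * (m + 1)) / (2 * m * ((m + 1) * √(m + 1)))) +
      S * (3 / (2 * m * ((m + 1) * √(m + 1)))) =
      (S + 12 * m) * (m + 3 / 2) / (m * ((m + 1) * √(m + 1))) := by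
    field_simp
    ring
  rw [e, div_le_div_iff₀ (by positivity) (by positivity)]
  calc (S + 12 * m) * (m + 3 / 2) * (m * √m) = (S + 12 * m) * m * ((m + 3 / 2) * √m) := by ring
    _ ≤ (S + 12 * m) * m * ((m + 1) * √(m + 1)) := by gcongr
    _ = _ := by ring

/-- A multiple of the inverse degree of vertex `0`, which is a nonnegative supermartingale along
preferential attachment as long as that degree is at least `2`. -/
def invDegPotential (n : ℕ) (G : SimpleGraph ℕ) : ℝ :=
  √(n - 1) / ((degN G 0 - 1 : ℕ) : ℝ)

theorem invDegPotential_nonneg (n : ℕ) (G : SimpleGraph ℕ) : 0 ≤ invDegPotential n G := by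
  unfold invDegPotential
  positivity

theorem HasTreeSize.sum_invDegPotential_le {n : ℕ} (hn : 2 ≤ n) {G : SimpleGraph ℕ}
    (hG : HasTreeSize n G) (h0 : 2 ≤ degN G 0) :
    ∑ v ∈ Finset.range n, (degN G v : ℝ) / (2 * ((n : ℝ) - 1)) *
      invDegPotential (n + 1) (_root_.addEdge G n v) ≤ invDegPotential n G := by
  obtain ⟨m, hm⟩ : ∃ m : ℝ, m = (n : ℝ) - 1 := ⟨_, rfl⟩
  have hm1 : 1 ≤ m := by
    have : (2 : ℝ) ≤ n := by exact_mod_cast hn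
    linarith
  have hD := hG.sum_degN_cast (by omega)
  obtain ⟨d, hd⟩ : ∃ d, degN G 0 = d + 2 := ⟨degN G 0 - 2, by omega⟩
  have hd0 : (degN G 0 : ℝ) = d + 2 := by rw [hd]; push_cast; ring
  have hstep : ∀ v ∈ Finset.range n, (degN G v : ℝ) / (2 * ((n : ℝ) - 1)) *
      invDegPotential (n + 1) (_root_.addEdge G n v) =
      (degN G v : ℝ) * (√(m + 1) / (2 * m * (d + 1))) +
      if v = 0 then (degN G v : ℝ) * (√(m + 1) / (2 * m) * (1 / (d + 2) - 1 / (d + 1))) else 0 := by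
    intro v hv
    have : ((n + 1 : ℕ) : ℝ) - 1 = m + 1 := by push_cast; linarith
    rw [invDegPotential, this, hG.degN_addEdge (Finset.mem_range.mp hv) (by omega), ← hm, hd]
    by_cases hv0 : v = 0
    · rw [if_pos hv0.symm, if_pos hv0]
      push_cast
      field_simp
      simp
    · rw [if_neg (Ne.symm hv0), if_neg hv0]
      push_cast
      field_simp
      simp
  rw [Finset.sum_congr rfl hstep, Finset.sum_add_distrib, ← Finset.sum_mul, hD,
    Finset.sum_ite_eq', if_pos (Finset.mem_range.mpr (by omega)), hd0, ← hm, invDegPotential, hd,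
    ← hm]
  have hm0 : 0 < √m := Real.sqrt_pos.mpr (by linarith)
  have hsq : (2 * m - 1) * √(m + 1) ≤ 2 * m * √m := by
    apply le_of_sq_le_sq _ (by positivity)
    rw [mul_pow, mul_pow, Real.sq_sqrt (by linarith), Real.sq_sqrt (by linarith)]
    nlinarith
  have e : 2 * m * (√(m + 1) / (2 * m * (d + 1))) +
      ((d : ℝ) + 2) * (√(m + 1) / (2 * m) * (1 / (d + 2) - 1 / (d + 1))) =
      ((2 * m - 1) * √(m + 1)) / (2 * m * (d + 1)) := by
    field_simp
    ring
  rw [e, div_le_div_iff₀ (by positivity) (by simp; positivity)]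
  have hc : ((d + 2 - 1 : ℕ) : ℝ) = d + 1 := by simp
  rw [hc]
  calc (2 * m - 1) * √(m + 1) * (d + 1) ≤ 2 * m * √m * (d + 1) := by gcongr
    _ = _ := by ring

/-- The isomorphism types of graphs with a vertex of degree larger than `c`. -/
def largeDegreeTypes (c : ℝ) : Set GraphType :=
  {q | ∃ G, Quotient.mk graphSetoid G = q ∧ ∃ v, c < degN G v}

theorem mk_mem_largeDegreeTypes {c : ℝ} {G : SimpleGraph ℕ} :
    Quotient.mk graphSetoid G ∈ largeDegreeTypes c ↔ ∃ v, c < degN G v := by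
  constructor
  · rintro ⟨H, hH, v, hv⟩
    obtain ⟨e⟩ := Quotient.exact hH
    exact ⟨e v, by rwa [degN_eq_of_iso]⟩
  · intro h
    exact ⟨G, rfl, h⟩

theorem PAtype_apply (k : ℕ) (T : SimpleGraph ℕ) (m : ℕ) (A : Set GraphType) :
    PAtype k T (k + m) A = PAlawAux k T m {G | Quotient.mk graphSetoid G ∈ A} := by
  rw [PAtype, PAlaw, Nat.add_sub_cancel_left]
  exact Measure.map_apply (f := fun G => (Quotient.mk graphSetoid G : GraphType))
    measurable_from_top MeasurableSpace.measurableSet_top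

theorem PAtype_largeDegreeTypes_le {k : ℕ} (hk : 2 ≤ k) {T : SimpleGraph ℕ}
    (hT : HasTreeSize k T) {t : ℝ} (ht : 0 < t) {n : ℕ} (hn : k ≤ n) :
    PAtype k T n (largeDegreeTypes (t * √((n : ℝ) - 1))) ≤
      ENNReal.ofReal (cubicPotential k T / t ^ 3) := by
  obtain ⟨m, rfl⟩ := Nat.exists_eq_add_of_le hn
  rw [PAtype_apply]
  have hs : ∀ n G v, k ≤ n → HasTreeSize n G → degN G v ≠ 0 →
      HasTreeSize (n + 1) (addEdge G n v) :=
    fun n G v _ hG hv => hG.addEdge (hG.lt_of_degN_ne_zero hv)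
  have hint := lintegral_PAlawAux_le (F := fun n G => ENNReal.ofReal (cubicPotential n G)) hT hs
    (fun n G hn hG => by
      rw [hG.lintegral_paStep_ofReal (by omega) _ fun H => cubicPotential_nonneg (by omega) H]
      exact ENNReal.ofReal_le_ofReal (hG.sum_cubicPotential_le (by omega))) m
  have hN : (1 : ℝ) ≤ ((k + m : ℕ) : ℝ) - 1 := by
    have : (2 : ℝ) ≤ ((k + m : ℕ) : ℝ) := by exact_mod_cast (by omega : 2 ≤ k + m)
    linarith
  have hmarkov := meas_ge_le_lintegral_div (μ := PAlawAux k T m)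
    (f := fun G => ENNReal.ofReal (cubicPotential (k + m) G)) measurable_from_top.aemeasurable
    (ε := ENNReal.ofReal (t ^ 3)) (by simpa using pow_pos ht 3) ENNReal.ofReal_ne_top
  rw [ENNReal.ofReal_div_of_pos (by positivity)]
  refine le_trans ?_ (hmarkov.trans (ENNReal.div_le_div_right hint _))
  refine measure_mono_ae ?_
  filter_upwards [ae_PAlawAux hT hs m] with G hG hmem
  obtain ⟨v, hv⟩ := mk_mem_largeDegreeTypes.mp hmem
  refine ENNReal.ofReal_le_ofReal ?_
  generalize hx : ((k + m : ℕ) : ℝ) - 1 = x at *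
  have hx0 : 0 < √x := Real.sqrt_pos.mpr (by linarith)
  have hvn : v < k + m := hG.lt_of_degN_ne_zero fun h0 => by
    rw [h0, Nat.cast_zero] at hv
    exact absurd hv (not_lt.mpr (by positivity))
  rw [cubicPotential, hx, le_div_iff₀ (by positivity)]
  calc t ^ 3 * (x * √x) = (t * √x) ^ 3 := by
        rw [mul_pow, pow_succ √x, Real.sq_sqrt (by linarith)]
    _ ≤ (degN G v : ℝ) ^ 3 := by gcongr
    _ ≤ (degN G v : ℝ) * (degN G v + 1) * (degN G v + 2) := by
        have : (0 : ℝ) ≤ degN G v := by positivity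
        nlinarith [mul_nonneg this this]
    _ ≤ ∑ w ∈ Finset.range (k + m), (degN G w : ℝ) * (degN G w + 1) * (degN G w + 2) :=
        Finset.single_le_sum (f := fun w => (degN G w : ℝ) * (degN G w + 1) * (degN G w + 2))
          (fun w _ => by positivity) (Finset.mem_range.mpr hvn)
    _ ≤ _ := by linarith

theorem PAtype_starGraph_compl_largeDegreeTypes_le {k : ℕ} (hk : 3 ≤ k) {t : ℝ} (ht : 0 < t)
    {n : ℕ} (hn : k ≤ n) :
    PAtype k (starGraph k) n (largeDegreeTypes (t * √((n : ℝ) - 1)))ᶜ ≤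
      ENNReal.ofReal (t * (√((k : ℝ) - 1) / ((k : ℝ) - 2))) := by
  obtain ⟨m, rfl⟩ := Nat.exists_eq_add_of_le hn
  rw [PAtype_apply]
  have h0 : HasTreeSize k (starGraph k) ∧ 2 ≤ degN (starGraph k) 0 :=
    ⟨hasTreeSize_starGraph (by omega), by rw [degN_starGraph_zero]; omega⟩
  have hs : ∀ n G v, k ≤ n → (HasTreeSize n G ∧ 2 ≤ degN G 0) → degN G v ≠ 0 →
      HasTreeSize (n + 1) (addEdge G n v) ∧ 2 ≤ degN (addEdge G n v) 0 := by
    rintro n G v hn ⟨hG, hG0⟩ hv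
    have hvn := hG.lt_of_degN_ne_zero hv
    refine ⟨hG.addEdge hvn, ?_⟩
    rw [hG.degN_addEdge hvn (by omega)]
    omega
  have hint := lintegral_PAlawAux_le (I := fun n G => HasTreeSize n G ∧ 2 ≤ degN G 0)
    (F := fun n G => ENNReal.ofReal (invDegPotential n G)) h0 hs
    (fun n G hn hG => by
      rw [hG.1.lintegral_paStep_ofReal (by omega) _ (invDegPotential_nonneg _)]
      exact ENNReal.ofReal_le_ofReal (hG.1.sum_invDegPotential_le (by omega) hG.2)) m
  have hmarkov := meas_ge_le_lintegral_div (μ := PAlawAux k (starGraph k) m)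
    (f := fun G => ENNReal.ofReal (invDegPotential (k + m) G)) measurable_from_top.aemeasurable
    (ε := ENNReal.ofReal t⁻¹) (by simpa using ht) ENNReal.ofReal_ne_top
  have hstart : invDegPotential k (starGraph k) = √((k : ℝ) - 1) / ((k : ℝ) - 2) := by
    rw [invDegPotential, degN_starGraph_zero, Nat.sub_sub, Nat.cast_sub (by omega)]
    norm_num
  have hbound : ENNReal.ofReal (t * (√((k : ℝ) - 1) / ((k : ℝ) - 2))) =
      ENNReal.ofReal (invDegPotential k (starGraph k)) / ENNReal.ofReal t⁻¹ := by
    rw [← ENNReal.ofReal_div_of_pos (by positivity), hstart, div_inv_eq_mul, mul_comm]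
  rw [hbound]
  refine le_trans ?_ (hmarkov.trans (ENNReal.div_le_div_right hint _))
  refine measure_mono_ae ?_
  filter_upwards [ae_PAlawAux (I := fun n G => HasTreeSize n G ∧ 2 ≤ degN G 0) h0 hs m]
    with G hG hmem
  have hdeg : (degN G 0 : ℝ) ≤ t * √(((k + m : ℕ) : ℝ) - 1) := by
    by_contra h
    exact hmem (mk_mem_largeDegreeTypes.mpr ⟨0, not_le.mp h⟩)
  refine ENNReal.ofReal_le_ofReal ?_
  have hpos : (0 : ℝ) < ((degN G 0 - 1 : ℕ) : ℝ) := by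
    exact_mod_cast (by omega : 0 < degN G 0 - 1)
  have hle : ((degN G 0 - 1 : ℕ) : ℝ) ≤ degN G 0 := by
    exact_mod_cast Nat.sub_le _ _
  rw [invDegPotential, le_div_iff₀ hpos, inv_mul_le_iff₀ ht]
  exact hle.trans hdeg

theorem abs_sub_toReal_le_one {α : Type*} [MeasurableSpace α] (μ ν : Measure α)
    [IsProbabilityMeasure μ] [IsProbabilityMeasure ν] (A : Set α) :
    |(μ A).toReal - (ν A).toReal| ≤ 1 := by
  have h1 : (μ A).toReal ≤ 1 := measureReal_le_one
  have h2 : (ν A).toReal ≤ 1 := measureReal_le_one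
  have h3 : 0 ≤ (μ A).toReal := ENNReal.toReal_nonneg
  have h4 : 0 ≤ (ν A).toReal := ENNReal.toReal_nonneg
  rw [abs_le]
  constructor <;> linarith

theorem tvDist_le_one {α : Type*} [MeasurableSpace α] (μ ν : Measure α)
    [IsProbabilityMeasure μ] [IsProbabilityMeasure ν] : tvDist μ ν ≤ 1 :=
  ciSup_le fun A => abs_sub_toReal_le_one μ ν A

theorem le_tvDist {α : Type*} [MeasurableSpace α] (μ ν : Measure α)
    [IsProbabilityMeasure μ] [IsProbabilityMeasure ν] (A : Set α) :
    |(μ A).toReal - (ν A).toReal| ≤ tvDist μ ν :=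
  le_ciSup (f := fun A : Set α => |(μ A).toReal - (ν A).toReal|)
    ⟨1, by rintro _ ⟨B, rfl⟩; exact abs_sub_toReal_le_one μ ν B⟩ A

theorem le_tvDist_PAtype {k kT n : ℕ} (hk : 3 ≤ k) (hkT : 2 ≤ kT) {T : SimpleGraph ℕ}
    (hT : HasTreeSize kT T) (hkn : k ≤ n) (hkTn : kT ≤ n) {t : ℝ} (ht : 0 < t) :
    1 - t * (√((k : ℝ) - 1) / ((k : ℝ) - 2)) - cubicPotential kT T / t ^ 3 ≤
      tvDist (PAtype k (starGraph k) n) (PAtype kT T n) := by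
  have := isProbabilityMeasure_PAtype (by omega) (hasTreeSize_starGraph (k := k) (by omega)) n
  have := isProbabilityMeasure_PAtype hkT hT n
  have hk' : (3 : ℝ) ≤ k := by exact_mod_cast hk
  have h1 := ENNReal.toReal_le_of_le_ofReal
    (div_nonneg (cubicPotential_nonneg (by omega) T) (by positivity))
    (PAtype_largeDegreeTypes_le hkT hT ht hkTn)
  have h2 := ENNReal.toReal_le_of_le_ofReal
    (mul_nonneg ht.le (div_nonneg (Real.sqrt_nonneg _) (by linarith)))
    (PAtype_starGraph_compl_largeDegreeTypes_le hk ht hkn)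
  have h3 := probReal_compl_eq_one_sub (μ := PAtype k (starGraph k) n)
    (s := largeDegreeTypes (t * √((n : ℝ) - 1))) MeasurableSpace.measurableSet_top
  have h4 := (le_abs_self _).trans (le_tvDist (PAtype k (starGraph k) n) (PAtype kT T n)
    (largeDegreeTypes (t * √((n : ℝ) - 1))))
  simp only [Measure.real] at h3
  linarith

theorem deltaPA_starGraph_bounds {k kT : ℕ} (hk : 3 ≤ k) (hkT : 2 ≤ kT) {T : SimpleGraph ℕ}
    (hT : HasTreeSize kT T) {t : ℝ} (ht : 0 < t) :
    1 - t * (√((k : ℝ) - 1) / ((k : ℝ) - 2)) - cubicPotential kT T / t ^ 3 ≤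
      deltaPA k (starGraph k) kT T ∧ deltaPA k (starGraph k) kT T ≤ 1 := by
  have hle : ∀ n, tvDist (PAtype k (starGraph k) n) (PAtype kT T n) ≤ 1 := fun n => by
    have := isProbabilityMeasure_PAtype (by omega) (hasTreeSize_starGraph (k := k) (by omega)) n
    have := isProbabilityMeasure_PAtype hkT hT n
    exact tvDist_le_one _ _
  have hge : ∀ᶠ n in atTop,
      1 - t * (√((k : ℝ) - 1) / ((k : ℝ) - 2)) - cubicPotential kT T / t ^ 3 ≤
        tvDist (PAtype k (starGraph k) n) (PAtype kT T n) := by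
    filter_upwards [eventually_ge_atTop k, eventually_ge_atTop kT] with n h1 h2
    exact le_tvDist_PAtype hk hkT hT h1 h2 ht
  constructor
  · exact le_limsup_of_frequently_le hge.frequently
      (isBoundedUnder_of_eventually_le (.of_forall hle))
  · exact limsup_le_of_le (isCoboundedUnder_le_of_eventually_le _ hge) (.of_forall hle)

theorem tendsto_sqrt_natCast_sub_one :
    Tendsto (fun k : ℕ => √((k : ℝ) - 1)) atTop atTop :=
  tendsto_sqrt_atTop.comp (tendsto_atTop_add_const_right _ (-1) tendsto_natCast_atTop_atTop)


/-- For any fixed seed tree `T` on at least 2 vertices, `δ(S_k, T) → 1` as `k → ∞`,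
where `S_k` is the star on `k` vertices. -/
theorem delta_star_tendsto_one
    (kT : ℕ) (hkT : 2 ≤ kT) (T : SimpleGraph ℕ) (hT : IsTreeOn kT T) :
    Filter.Tendsto (fun k : ℕ => deltaPA k (starGraph k) kT T) Filter.atTop (nhds 1) := by
  have hs : Tendsto (fun k : ℕ => √√((k : ℝ) - 1)) atTop atTop :=
    tendsto_sqrt_atTop.comp tendsto_sqrt_natCast_sub_one
  have hinv : Tendsto (fun k : ℕ => (√√((k : ℝ) - 1))⁻¹) atTop (nhds 0) :=
    tendsto_inv_atTop_zero.comp hs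
  have hlow : Tendsto (fun k : ℕ => 1 - 2 * (√√((k : ℝ) - 1))⁻¹ -
      cubicPotential kT T * (√√((k : ℝ) - 1))⁻¹ ^ 3) atTop (nhds 1) := by
    simpa using (tendsto_const_nhds (x := (1 : ℝ))).sub (hinv.const_mul 2) |>.sub
      ((hinv.pow 3).const_mul (cubicPotential kT T))
  refine tendsto_of_tendsto_of_tendsto_of_le_of_le' hlow tendsto_const_nhds ?_ ?_
  · filter_upwards [eventually_ge_atTop 3] with k hk
    have hk' : (3 : ℝ) ≤ k := by exact_mod_cast hk
    have hpos : 0 < √√((k : ℝ) - 1) := Real.sqrt_pos.mpr (Real.sqrt_pos.mpr (by linarith))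
    refine le_trans ?_ (deltaPA_starGraph_bounds hk hkT hT.hasTreeSize hpos).1
    generalize hx : √√((k : ℝ) - 1) = x at *
    have hx2 : √((k : ℝ) - 1) = x ^ 2 := by
      rw [← hx, Real.sq_sqrt (Real.sqrt_nonneg _)]
    have hx4 : (k : ℝ) = x ^ 4 + 1 := by
      have := Real.sq_sqrt (show (0 : ℝ) ≤ (k : ℝ) - 1 by linarith)
      rw [hx2] at this
      linarith
    rw [hx2]
    have h1 : x * (x ^ 2 / ((k : ℝ) - 2)) ≤ 2 * x⁻¹ := by
      rw [← mul_div_assoc, ← div_eq_mul_inv, div_le_div_iff₀ (by linarith) hpos]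
      rw [hx4] at hk' ⊢
      nlinarith
    rw [inv_pow, ← div_eq_mul_inv (cubicPotential kT T)]
    linarith
  · filter_upwards [eventually_ge_atTop 3] with k hk
    exact (deltaPA_starGraph_bounds hk hkT hT.hasTreeSize one_pos).2


end
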